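/- Let (W,S) be a Coxeter system with |S| ≤ ℵ₀. Then the poset (W̄, ≤) under the weak order contains maximal elements, and every element w ∈ W̄ is less than or equal to some maximal element. -/

import Mathlib

namespace CoxInf

variable {B : Type*} {W : Type*} [Group W] {M : CoxeterMatrix B}

/-- The inversion set `Φ_w` of `w⁻¹`, encoded via the canonical bijection between the
positive roots and the reflections: it corresponds to the set of left inversions of `w`. -/
def invSet (cs : CoxeterSystem M W) (w : W) : Set W :=
  {t | cs.IsLeftInversion w t}

/-- The length-`n` prefix of an infinite word in the generators. -/
def prefixWord (ω : ℕ → B) (n : ℕ) : List B := List.ofFn fun i : Fin n => ω i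

/-- `ω` is an infinite reduced expression: every finite prefix is reduced. -/
def IsInfRedExpr (cs : CoxeterSystem M W) (ω : ℕ → B) : Prop :=
  ∀ n, cs.IsReduced (prefixWord ω n)

/-- The elements of `W̄ = W ⊎ W_l`, represented as finite elements together with
infinite reduced expressions (an infinite reduced word is an equivalence class of
infinite reduced expressions having the same inversion set). -/
def barInv (cs : CoxeterSystem M W) : W ⊕ {ω : ℕ → B // IsInfRedExpr cs ω} → Set W
  | .inl w => invSet cs w
  | .inr ω => ⋃ n, invSet cs (cs.wordProd (prefixWord ω.1 n))

end CoxInf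
namespace CoxInf

open CoxeterSystem List

variable {B : Type*} {W : Type*} [Group W] {M : CoxeterMatrix B}

section ReflectionCocycle

open Classical in
/-- The action of a simple reflection on signed group elements: conjugate by `s i` and flip the
sign exactly at `s i`. -/
noncomputable def signedSimple (cs : CoxeterSystem M W) (i : B) : Function.End (W × ZMod 2) :=
  fun p => (cs.simple i * p.1 * cs.simple i, p.2 + if p.1 = cs.simple i then 1 else 0)

open Classical in
theorem signedSimple_mul_pow_apply (cs : CoxeterSystem M W) (i j : B) (n : ℕ) (p : W × ZMod 2) :
    ((signedSimple cs i * signedSimple cs j) ^ n) p =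
      ((cs.simple i * cs.simple j) ^ n * p.1 * ((cs.simple i * cs.simple j) ^ n)⁻¹,
        p.2 + ∑ l ∈ Finset.range (2 * n),
          if p.1 = ((cs.simple i * cs.simple j) ^ l)⁻¹ * cs.simple j then 1 else 0) := by
  set x := cs.simple i * cs.simple j with hx
  have hpow : ∀ k : ℕ, cs.simple j * x ^ k = (x ^ k)⁻¹ * cs.simple j := by
    intro k
    have hk : cs.simple j * x ^ k * (cs.simple j)⁻¹ = (x⁻¹) ^ k := by
      rw [← conj_pow]
      congr 1
      simp [hx, mul_assoc]
    rw [← inv_pow, ← hk]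
    simp
  induction n with
  | zero => simp [Function.End.one_def]
  | succ n ih =>
    have h0 : ∀ r : W, x ^ n * p.1 * (x ^ n)⁻¹ = r ↔ p.1 = (x ^ n)⁻¹ * r * x ^ n := by
      intro r
      constructor
      · rintro rfl
        group
      · intro h
        rw [h]
        group
    have h1 : x ^ n * p.1 * (x ^ n)⁻¹ = cs.simple j ↔ p.1 = (x ^ (2 * n))⁻¹ * cs.simple j := by
      rw [h0, mul_assoc, hpow, ← mul_assoc, two_mul, pow_add, mul_inv_rev]
    have h2 : cs.simple j * (x ^ n * p.1 * (x ^ n)⁻¹) * cs.simple j = cs.simple i ↔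
        p.1 = (x ^ (2 * n + 1))⁻¹ * cs.simple j := by
      have e : cs.simple j * (x ^ n * p.1 * (x ^ n)⁻¹) * cs.simple j = cs.simple i ↔
          x ^ n * p.1 * (x ^ n)⁻¹ = cs.simple j * x := by
        constructor
        · intro h
          have := congrArg (fun y => cs.simple j * y * cs.simple j) h
          simpa [hx, mul_assoc] using this
        · intro h
          rw [h]
          simp [hx, mul_assoc]
      rw [e, h0, mul_assoc, mul_assoc, ← pow_succ', hpow, ← mul_assoc, ← mul_inv_rev, ← pow_add]
      rw [show n + 1 + n = 2 * n + 1 by ring]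
    rw [pow_succ']
    change signedSimple cs i (signedSimple cs j
      (((signedSimple cs i * signedSimple cs j) ^ n) p)) = _
    rw [ih]
    simp only [signedSimple, h1, h2, show 2 * (n + 1) = 2 * n + 1 + 1 by ring,
      Finset.sum_range_succ, Prod.mk.injEq]
    constructor
    · rw [pow_succ' x n, mul_inv_rev]
      simp [hx, mul_assoc]
    · ring

theorem isLiftable_signedSimple (cs : CoxeterSystem M W) : M.IsLiftable (signedSimple cs) := by
  classical
  intro i j
  funext p
  rw [signedSimple_mul_pow_apply]
  rw [two_mul, Finset.sum_range_add]
  simp only [pow_add, simple_mul_simple_pow, one_mul, CharTwo.add_self_eq_zero]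
  simp [Function.End.one_def]

/-- The action of `W` on signed group elements extending `signedSimple`. -/
noncomputable def signedHom (cs : CoxeterSystem M W) : W →* Function.End (W × ZMod 2) :=
  cs.lift ⟨signedSimple cs, isLiftable_signedSimple cs⟩

/-- The sign picked up by `t` under the signed action of `w`. -/
noncomputable def signCocycle (cs : CoxeterSystem M W) (w t : W) : ZMod 2 :=
  (signedHom cs w (t, 0)).2

theorem signedHom_apply (cs : CoxeterSystem M W) (w : W) (p : W × ZMod 2) :
    signedHom cs w p = (w * p.1 * w⁻¹, p.2 + signCocycle cs w p.1) := by
  induction w using cs.simple_induction_left generalizing p with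
  | one => simp [signCocycle, Function.End.one_def]
  | mul_simple_left w i ih =>
    have key : ∀ q, signedHom cs (cs.simple i * w) q = signedSimple cs i (signedHom cs w q) := by
      intro q
      rw [map_mul]
      change signedHom cs (cs.simple i) (signedHom cs w q) = _
      rw [signedHom, lift_apply_simple]
    rw [signCocycle, key, key, ih, ih]
    simp [signedSimple, mul_assoc, add_assoc]

theorem signCocycle_mul (cs : CoxeterSystem M W) (u w t : W) :
    signCocycle cs (u * w) t = signCocycle cs w t + signCocycle cs u (w * t * w⁻¹) := by
  rw [signCocycle, map_mul]
  change (signedHom cs u (signedHom cs w (t, 0))).2 = _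
  simp [signedHom_apply]

open Classical in
theorem signCocycle_simple (cs : CoxeterSystem M W) (i : B) (t : W) :
    signCocycle cs (cs.simple i) t = if t = cs.simple i then 1 else 0 := by
  rw [signCocycle, signedHom, lift_apply_simple]
  simp [signedSimple]

theorem signCocycle_one (cs : CoxeterSystem M W) (t : W) : signCocycle cs 1 t = 0 := by
  simp [signCocycle, Function.End.one_def]

open Classical in
theorem mem_rightInvSeq_of_signCocycle_ne_zero (cs : CoxeterSystem M W) (ω : List B) {t : W}
    (h : signCocycle cs (cs.wordProd ω) t ≠ 0) : t ∈ cs.rightInvSeq ω := by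
  induction ω with
  | nil => simp [signCocycle_one] at h
  | cons i ω ih =>
    rw [rightInvSeq, mem_cons]
    by_cases h' : signCocycle cs (cs.wordProd ω) t = 0
    · rw [wordProd_cons, signCocycle_mul, h', signCocycle_simple, zero_add] at h
      left
      have := (ite_ne_right_iff.mp h).1
      rw [← this]
      group
    · exact Or.inr (ih h')

theorem isRightInversion_of_signCocycle_ne_zero (cs : CoxeterSystem M W) {w t : W}
    (h : signCocycle cs w t ≠ 0) : cs.IsRightInversion w t := by
  obtain ⟨ω, hω, rfl⟩ := cs.exists_isReduced w
  exact cs.isRightInversion_of_mem_rightInvSeq hω (mem_rightInvSeq_of_signCocycle_ne_zero cs ω h)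

theorem signCocycle_self (cs : CoxeterSystem M W) {t : W} (ht : cs.IsReflection t) :
    signCocycle cs t t = 1 := by
  obtain ⟨v, i, rfl⟩ := ht
  have h := signCocycle_mul cs v v⁻¹ (v * cs.simple i * v⁻¹)
  have e : v⁻¹ * (v * cs.simple i * v⁻¹) * v⁻¹⁻¹ = cs.simple i := by group
  rw [mul_inv_cancel, signCocycle_one, e] at h
  rw [signCocycle_mul, signCocycle_mul, e, signCocycle_simple, if_pos rfl]
  have e' : cs.simple i * cs.simple i * (cs.simple i)⁻¹ = cs.simple i := by simp
  rw [e', add_left_comm, ← h, add_zero]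

theorem isRightInversion_iff_signCocycle_ne_zero (cs : CoxeterSystem M W) {w t : W}
    (ht : cs.IsReflection t) : cs.IsRightInversion w t ↔ signCocycle cs w t ≠ 0 := by
  refine ⟨fun h h0 => ?_, isRightInversion_of_signCocycle_ne_zero cs⟩
  have h1 : signCocycle cs (w * t) t ≠ 0 := by
    rw [signCocycle_mul, signCocycle_self cs ht]
    simp [h0]
  exact ht.isRightInversion_mul_left_iff.mp (isRightInversion_of_signCocycle_ne_zero cs h1) h

theorem isLeftInversion_simple_mul_iff (cs : CoxeterSystem M W) {i : B} {u t : W}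
    (ht : t ≠ cs.simple i) :
    cs.IsLeftInversion (cs.simple i * u) t ↔
      cs.IsLeftInversion u (cs.simple i * t * cs.simple i) := by
  have hconj : cs.IsReflection (cs.simple i * t * cs.simple i) ↔ cs.IsReflection t := by
    simpa using cs.isReflection_conj_iff (cs.simple i) t
  by_cases hr : cs.IsReflection t
  · rw [← isRightInversion_inv_iff, ← isRightInversion_inv_iff,
      isRightInversion_iff_signCocycle_ne_zero cs hr,
      isRightInversion_iff_signCocycle_ne_zero cs (hconj.mpr hr), mul_inv_rev, signCocycle_mul,
      inv_simple, inv_simple, signCocycle_simple, if_neg ht, zero_add]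
  · exact ⟨fun h => absurd h.1 hr, fun h => absurd (hconj.mp h.1) hr⟩

end ReflectionCocycle

section WeakOrder

theorem finite_invSet (cs : CoxeterSystem M W) (w : W) : (invSet cs w).Finite := by
  induction w using cs.simple_induction_left with
  | one => simp [invSet, IsLeftInversion]
  | mul_simple_left w i ih =>
    refine ((ih.image fun t => cs.simple i * t * cs.simple i).insert (cs.simple i)).subset ?_
    intro t ht
    by_cases hti : t = cs.simple i
    · exact Or.inl hti
    · exact Or.inr ⟨_, (isLeftInversion_simple_mul_iff cs hti).mp ht, by simp [mul_assoc]⟩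

theorem invSet_subset_invSet_mul (cs : CoxeterSystem M W) {u v : W}
    (h : cs.length (u * v) = cs.length u + cs.length v) : invSet cs u ⊆ invSet cs (u * v) := by
  rintro t ⟨ht, hlt⟩
  refine ⟨ht, ?_⟩
  have := cs.length_mul_le (t * u) v
  rw [mul_assoc] at this
  lia

theorem length_eq_add_of_invSet_subset (cs : CoxeterSystem M W) {u w : W}
    (h : invSet cs u ⊆ invSet cs w) : cs.length w = cs.length u + cs.length (u⁻¹ * w) := by
  induction hn : cs.length u generalizing u w with
  | zero => simp [cs.length_eq_zero_iff.mp hn]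
  | succ n ih =>
    have hu : u ≠ 1 := by
      rintro rfl
      simp at hn
    obtain ⟨i, hi⟩ := cs.exists_leftDescent_of_ne_one hu
    have hu' : cs.length (cs.simple i * u) = n := by
      have := cs.isLeftDescent_iff.mp hi
      lia
    have hw : cs.IsLeftDescent w i :=
      (cs.isLeftInversion_simple_iff_isLeftDescent w i).mp
        (h ((cs.isLeftInversion_simple_iff_isLeftDescent u i).mpr hi))
    have hsub : invSet cs (cs.simple i * u) ⊆ invSet cs (cs.simple i * w) := by
      intro t ht
      have hti : t ≠ cs.simple i := by
        rintro rfl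
        have := ht.2
        rw [simple_mul_simple_cancel_left] at this
        exact absurd hi (not_lt.mpr this.le)
      rw [invSet, Set.mem_ofPred_eq, isLeftInversion_simple_mul_iff cs hti]
      exact h ((isLeftInversion_simple_mul_iff cs hti).mp ht)
    have hlen := ih hsub hu'
    have hw' := cs.isLeftDescent_iff.mp hw
    have e : (cs.simple i * u)⁻¹ * (cs.simple i * w) = u⁻¹ * w := by simp [mul_assoc]
    rw [e] at hlen
    lia

theorem exists_isReduced_append (cs : CoxeterSystem M W) {ω : List B} (hω : cs.IsReduced ω) {w : W}
    (h : invSet cs (cs.wordProd ω) ⊆ invSet cs w) :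
    ∃ ω', cs.IsReduced (ω ++ ω') ∧ cs.wordProd (ω ++ ω') = w := by
  obtain ⟨ω', hω', he⟩ := cs.exists_isReduced ((cs.wordProd ω)⁻¹ * w)
  have hprod : cs.wordProd (ω ++ ω') = w := by rw [wordProd_append, ← he, mul_inv_cancel_left]
  refine ⟨ω', ?_, hprod⟩
  rw [CoxeterSystem.IsReduced, hprod, length_append, length_eq_add_of_invSet_subset cs h, he, hω.eq, hω'.eq]

theorem invSet_wordProd_subset_append (cs : CoxeterSystem M W) {ω ω' : List B}
    (h : cs.IsReduced (ω ++ ω')) :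
    invSet cs (cs.wordProd ω) ⊆ invSet cs (cs.wordProd (ω ++ ω')) := by
  rw [wordProd_append]
  apply invSet_subset_invSet_mul
  have h₁ : cs.IsReduced ω := by simpa using h.take ω.length
  have h₂ : cs.IsReduced ω' := by simpa using h.drop ω.length
  rw [← wordProd_append, h.eq, h₁.eq, h₂.eq, length_append]

end WeakOrder

section InfiniteWords

theorem prefixWord_succ (ω : ℕ → B) (n : ℕ) : prefixWord ω (n + 1) = prefixWord ω n ++ [ω n] := by
  rw [prefixWord, List.ofFn_succ_last]
  simp [prefixWord]

theorem monotone_invSet_prefixWord (cs : CoxeterSystem M W) {ω : ℕ → B} (hω : IsInfRedExpr cs ω) :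
    Monotone fun n => invSet cs (cs.wordProd (prefixWord ω n)) := by
  refine monotone_nat_of_le_succ fun n => ?_
  have h := hω (n + 1)
  rw [prefixWord_succ] at h ⊢
  exact invSet_wordProd_subset_append cs h

/-- A finite part of the inversion set of an element of `W̄` is contained in the inversion set of a
smaller finite element. -/
theorem exists_invSet_of_finite_subset (cs : CoxeterSystem M W)
    (x : W ⊕ {ω : ℕ → B // IsInfRedExpr cs ω}) {F : Set W} (hF : F.Finite)
    (h : F ⊆ barInv cs x) : ∃ v, F ⊆ invSet cs v ∧ invSet cs v ⊆ barInv cs x := by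
  rcases x with w | ⟨ω, hω⟩
  · exact ⟨w, h, subset_rfl⟩
  · obtain ⟨n, hn⟩ := (monotone_invSet_prefixWord cs hω).directed_le
      |>.exists_mem_subset_of_finset_subset_biUnion (s := hF.toFinset) (by simpa [barInv] using h)
    exact ⟨_, by simpa using hn,
      Set.subset_iUnion (fun n => invSet cs (cs.wordProd (prefixWord ω n))) n⟩

theorem prefixWord_eq_take {L : ℕ → List B} (hL : ∀ m n, m ≤ n → L m <+: L n) (N : ℕ → ℕ)
    (hN : ∀ k, k < (L (N k)).length) {n k : ℕ} (hk : k ≤ (L n).length) :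
    prefixWord (fun k => (L (N k))[k]'(hN k)) k = (L n).take k := by
  refine List.ext_getElem (by simp [prefixWord, hk]) fun l h₁ h₂ => ?_
  simp only [prefixWord, List.getElem_ofFn, List.getElem_take]
  rcases le_total (N l) n with h | h
  · exact (hL _ _ h).getElem (hN l)
  · exact ((hL _ _ h).getElem _).symm

/-- An increasing sequence in the weak order has an upper bound in `W̄`. -/
theorem exists_barInv_upper_bound (cs : CoxeterSystem M W) {g : ℕ → W}
    (hg : Monotone fun n => invSet cs (g n)) :
    ∃ x : W ⊕ {ω : ℕ → B // IsInfRedExpr cs ω}, ∀ n, invSet cs (g n) ⊆ barInv cs x := by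
  have hstep : ∀ (n : ℕ) (ω : {ω : List B // cs.IsReduced ω ∧ cs.wordProd ω = g n}),
      ∃ ω' : {ω : List B // cs.IsReduced ω ∧ cs.wordProd ω = g (n + 1)}, ω.1 <+: ω'.1 := by
    rintro n ⟨ω, hω, he⟩
    have hsub : invSet cs (g n) ⊆ invSet cs (g (n + 1)) := hg n.le_succ
    rw [← he] at hsub
    obtain ⟨ω', h⟩ := exists_isReduced_append cs hω hsub
    exact ⟨⟨_, h⟩, prefix_append ω ω'⟩
  choose next hnext using hstep
  obtain ⟨ω₀, hω₀, he₀⟩ := cs.exists_isReduced (g 0)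
  let L : (n : ℕ) → {ω : List B // cs.IsReduced ω ∧ cs.wordProd ω = g n} :=
    fun n => Nat.rec ⟨ω₀, hω₀, he₀.symm⟩ next n
  have hL : ∀ m n, m ≤ n → (L m).1 <+: (L n).1 := by
    intro m n hmn
    induction n, hmn using Nat.le_induction with
    | base => exact prefix_rfl
    | succ n _ ih => exact ih.trans (hnext n (L n))
  by_cases hb : ∀ k, ∃ n, k < (L n).1.length
  · choose N hN using hb
    have htake {n k : ℕ} (hk : k ≤ (L n).1.length) := prefixWord_eq_take hL N hN hk
    refine ⟨.inr ⟨fun k => (L (N k)).1[k]'(hN k), fun k => ?_⟩, fun n => ?_⟩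
    · rw [htake (hN k).le]
      exact (L (N k)).2.1.take k
    · refine Set.subset_iUnion_of_subset (L n).1.length ?_
      rw [htake le_rfl, take_length, (L n).2.2]
  · push Not at hb
    obtain ⟨k, hk⟩ := hb
    obtain ⟨n, hn⟩ : ∃ n, ∀ m, (L m).1.length ≤ (L n).1.length := by
      have hfin : (Set.range fun n => (L n).1.length).Finite :=
        (Set.finite_Iic k).subset (Set.range_subset_iff.mpr hk)
      obtain ⟨_, ⟨n, rfl⟩, hn⟩ := hfin.exists_maximal (Set.range_nonempty _)
      exact ⟨n, fun m => (le_total _ _).elim id (hn ⟨m, rfl⟩)⟩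
    refine ⟨.inl (g n), fun m => ?_⟩
    rcases le_total m n with h | h
    · exact hg h
    · have := (hL n m h).eq_of_length ((hL n m h).length_le.antisymm (hn m))
      rw [← (L m).2.2, ← this, (L n).2.2]
      exact subset_rfl

theorem exists_upper_bound_of_isChain [Countable B] (cs : CoxeterSystem M W) {c : Set (Set W)}
    (hc : c ⊆ Set.range (barInv cs)) (hchain : IsChain (· ⊆ ·) c) (hne : c.Nonempty) :
    ∃ x, ∀ X ∈ c, X ⊆ barInv cs x := by
  have : Countable W := cs.wordProd_surjective.countable
  let D := {w : W // ∃ X ∈ c, invSet cs w ⊆ X}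
  have hdir : Directed (· ≤ ·) fun w : D => invSet cs w.1 := by
    rintro ⟨u, X, hX, hu⟩ ⟨v, Y, hY, hv⟩
    obtain ⟨Z, hZ, hXZ, hYZ⟩ := hchain.directedOn X hX Y hY
    obtain ⟨x, rfl⟩ := hc hZ
    obtain ⟨w, hw, hwx⟩ := exists_invSet_of_finite_subset cs x
      ((finite_invSet cs u).union (finite_invSet cs v))
      (Set.union_subset (hu.trans hXZ) (hv.trans hYZ))
    exact ⟨⟨w, _, hZ, hwx⟩, Set.union_subset_iff.mp hw⟩
  obtain ⟨X₀, hX₀⟩ := hne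
  have : Inhabited D := ⟨⟨1, X₀, hX₀, fun t ht => by simp [invSet, IsLeftInversion] at ht⟩⟩
  have : Encodable D := Encodable.ofCountable D
  obtain ⟨x, hx⟩ := exists_barInv_upper_bound cs hdir.sequence_mono
  refine ⟨x, fun X hX t ht => ?_⟩
  obtain ⟨y, rfl⟩ := hc hX
  obtain ⟨v, hv, hvy⟩ := exists_invSet_of_finite_subset cs y (Set.finite_singleton t)
    (Set.singleton_subset_iff.mpr ht)
  exact hx _ (hdir.le_sequence (⟨v, _, hX, hvy⟩ : D) (hv rfl))

end InfiniteWords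

end CoxInf

open CoxInf in
/-- If `(W,S)` is a Coxeter system with `|S| ≤ ℵ₀`, then `(W̄, ≤)` under the weak order
contains maximal elements, and every element of `W̄` is less than or equal to some
maximal element. -/
theorem wbar_has_maximal_elements
    {B : Type*} {W : Type*} [Group W] [Countable B] {M : CoxeterMatrix B}
    (cs : CoxeterSystem M W) :
    (∃ m : W ⊕ {ω : ℕ → B // IsInfRedExpr cs ω},
      ∀ y : W ⊕ {ω : ℕ → B // IsInfRedExpr cs ω},
        barInv cs m ⊆ barInv cs y → barInv cs y ⊆ barInv cs m) ∧
    ∀ w : W ⊕ {ω : ℕ → B // IsInfRedExpr cs ω},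
      ∃ m : W ⊕ {ω : ℕ → B // IsInfRedExpr cs ω},
        (∀ y : W ⊕ {ω : ℕ → B // IsInfRedExpr cs ω},
          barInv cs m ⊆ barInv cs y → barInv cs y ⊆ barInv cs m) ∧
        barInv cs w ⊆ barInv cs m := by
  have key : ∀ w : W ⊕ {ω : ℕ → B // IsInfRedExpr cs ω},
      ∃ m : W ⊕ {ω : ℕ → B // IsInfRedExpr cs ω},
        (∀ y : W ⊕ {ω : ℕ → B // IsInfRedExpr cs ω},
          barInv cs m ⊆ barInv cs y → barInv cs y ⊆ barInv cs m) ∧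
        barInv cs w ⊆ barInv cs m := by
    intro w
    obtain ⟨_, hw, ⟨m, rfl⟩, hm⟩ := zorn_subset_nonempty (Set.range (barInv cs))
      (fun c hc hchain hne =>
        let ⟨x, hx⟩ := exists_upper_bound_of_isChain cs hc hchain hne
        ⟨_, ⟨x, rfl⟩, hx⟩) (barInv cs w) ⟨w, rfl⟩
    exact ⟨m, fun y hy => hm ⟨y, rfl⟩ hy, hw⟩
  obtain ⟨m, hm, -⟩ := key (.inl 1)
  exact ⟨⟨m, hm⟩, key⟩
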